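/- arXiv:2605.12756 — 2 statements merged into one kernel-verified Lean document; each statement's English description precedes it below -/
import Mathlib

section
/- Under the setting of the symmetric-group theorem — m ≥ 2, nonuniform y ∈ Δ^{m−1}, Y the S_m-orbit matrix of y with n = m! columns, d ≥ m, E_W, E_H > 0, active constraints, α the unique solution of the closed system with parameter k = √(E_W E_H/(m!(m−1)Σ_i(α_i−y_i)²)), C = A − Y with A the S_m-orbit matrix of α, and γ = √(m!/(m−1))·‖α − y‖₂ — every global minimizer (W*, H*) satisfies: W*(W*)ᵀ = (E_W/(m−1))·(I_m − (1/m)·1_m 1_mᵀ), so the rows of W* form a simplex equiangular tight frame; (H*)ᵀH* = (E_H/((m−1)γ²))·CᵀC; and the logit matrix satisfies W*H* = −k·C. -/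
open scoped BigOperators
open Matrix

/-- Softmax function: `σ(z)_i = exp(z_i) / ∑_k exp(z_k)`. -/
noncomputable def softmax {m : ℕ} (u : Fin m → ℝ) : Fin m → ℝ :=
  fun i => Real.exp (u i) / ∑ k, Real.exp (u k)

/-- Cross-entropy loss `L(q, p) = −∑ᵢ pᵢ log qᵢ`. -/
noncomputable def crossEnt {m : ℕ} (q p : Fin m → ℝ) : ℝ :=
  -∑ i, p i * Real.log (q i)

/-- Squared Frobenius norm `‖A‖_F²`. -/
noncomputable def frobSq {m n : Type*} [Fintype m] [Fintype n] (A : Matrix m n ℝ) : ℝ :=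
  ∑ i, ∑ j, (A i j) ^ 2

/-- The layer-peeled objective `J(W,H;Y) = ∑ⱼ L(σ((WH)_{:,j}), Y_{:,j})`. -/
noncomputable def lpObj {m d : ℕ} {n : Type*} [Fintype n]
    (W : Matrix (Fin m) (Fin d) ℝ) (H : Matrix (Fin d) n ℝ) (Y : Matrix (Fin m) n ℝ) : ℝ :=
  ∑ j, crossEnt (softmax (fun i => (W * H) i j)) (fun i => Y i j)

/-- `(W, H)` is a global minimizer of the constrained layer-peeled problem
`min J(W,H;Y)` subject to `‖W‖_F² ≤ E_W` and `‖H‖_F² ≤ E_H`. -/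
def IsGlobalMin {m d : ℕ} {n : Type*} [Fintype n] (EW EH : ℝ) (Y : Matrix (Fin m) n ℝ)
    (W : Matrix (Fin m) (Fin d) ℝ) (H : Matrix (Fin d) n ℝ) : Prop :=
  frobSq W ≤ EW ∧ frobSq H ≤ EH ∧
  ∀ (W' : Matrix (Fin m) (Fin d) ℝ) (H' : Matrix (Fin d) n ℝ),
    frobSq W' ≤ EW → frobSq H' ≤ EH → lpObj W H Y ≤ lpObj W' H' Y

/-- The real permutation matrix `ρ(g)` of a permutation `g`, acting on coordinates. -/
def permMat {m : ℕ} (g : Equiv.Perm (Fin m)) : Matrix (Fin m) (Fin m) ℝ :=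
  Matrix.of fun i j => if i = g j then 1 else 0

/-- The orthogonal projection of `ℝ^m` onto the vectors with coordinate sum zero. -/
noncomputable def centering (m : ℕ) : Matrix (Fin m) (Fin m) ℝ :=
  (1 : Matrix (Fin m) (Fin m) ℝ) - ((1 : ℝ) / (m : ℝ)) • Matrix.of (fun _ _ => (1 : ℝ))

lemma centering_apply {m : ℕ} (i j : Fin m) :
    centering m i j = (if i = j then 1 else 0) - 1 / (m : ℝ) := by
  simp [centering, Matrix.one_apply]

lemma centering_transpose (m : ℕ) : (centering m)ᵀ = centering m := by
  ext i j
  simp [centering_apply, eq_comm]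

lemma centering_mul_apply {m : ℕ} {n : Type*} (B : Matrix (Fin m) n ℝ) (i : Fin m) (j : n) :
    (centering m * B) i j = B i j - (1 / (m : ℝ)) * ∑ l, B l j := by
  simp [Matrix.mul_apply, centering_apply, sub_mul, Finset.sum_sub_distrib, Finset.mul_sum]

lemma centering_mul_of_sum_eq_zero {m : ℕ} {n : Type*} (B : Matrix (Fin m) n ℝ)
    (hB : ∀ j, ∑ i, B i j = 0) : centering m * B = B := by
  ext i j
  simp [centering_mul_apply, hB]

lemma sum_centering {m : ℕ} (hm : 0 < m) (j : Fin m) : ∑ i, centering m i j = 0 := by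
  have : (m : ℝ) ≠ 0 := by positivity
  simp [centering_apply, Finset.sum_sub_distrib, this]

lemma trace_centering {m : ℕ} (hm : 0 < m) : (centering m).trace = (m : ℝ) - 1 := by
  have : (m : ℝ) ≠ 0 := by positivity
  simp [Matrix.trace, centering_apply]
  field_simp

lemma frobSq_nonneg {m n : Type*} [Fintype m] [Fintype n] (A : Matrix m n ℝ) : 0 ≤ frobSq A :=
  Finset.sum_nonneg fun _ _ => Finset.sum_nonneg fun _ _ => sq_nonneg _

lemma eq_zero_of_frobSq_eq_zero {m n : Type*} [Fintype m] [Fintype n] {A : Matrix m n ℝ}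
    (h : frobSq A = 0) : A = 0 := by
  ext i j
  have h1 := (Finset.sum_eq_zero_iff_of_nonneg
    (fun i _ => Finset.sum_nonneg fun j _ => sq_nonneg (A i j))).1 h i (Finset.mem_univ i)
  have h2 := (Finset.sum_eq_zero_iff_of_nonneg (fun j _ => sq_nonneg (A i j))).1 h1 j
    (Finset.mem_univ j)
  simpa using h2

lemma frobSq_eq_trace {m n : Type*} [Fintype m] [Fintype n] (A : Matrix m n ℝ) :
    frobSq A = (A * Aᵀ).trace := by
  simp [frobSq, Matrix.trace, Matrix.mul_apply, sq]

lemma frobSq_transpose {m n : Type*} [Fintype m] [Fintype n] (A : Matrix m n ℝ) :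
    frobSq Aᵀ = frobSq A := by
  simp only [frobSq, Matrix.transpose_apply]
  exact Finset.sum_comm

lemma frobSq_add_smul {m n : Type*} [Fintype m] [Fintype n] (A B : Matrix m n ℝ) (s : ℝ) :
    frobSq (A + s • B) = frobSq A + 2 * s * (A * Bᵀ).trace + s ^ 2 * frobSq B := by
  simp only [frobSq, Matrix.trace, Matrix.mul_apply, Finset.mul_sum, ← Finset.sum_add_distrib,
    Matrix.diag_apply, Matrix.transpose_apply, Matrix.add_apply, Matrix.smul_apply, smul_eq_mul]
  exact Finset.sum_congr rfl fun i _ => Finset.sum_congr rfl fun j _ => by ring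

lemma frobSq_smul {m n : Type*} [Fintype m] [Fintype n] (A : Matrix m n ℝ) (s : ℝ) :
    frobSq (s • A) = s ^ 2 * frobSq A := by
  simp [frobSq, Finset.mul_sum, mul_pow]

/-- The squared Frobenius norm drops under centering by the contribution of the column sums. -/
lemma trace_centering_quadratic {m : ℕ} {n : Type*} [Fintype n] (W : Matrix (Fin m) n ℝ) :
    (Wᵀ * (centering m * W)).trace =
      frobSq W - (1 / (m : ℝ)) * ∑ l, (∑ i, W i l) ^ 2 := by
  simp only [Matrix.trace, Matrix.diag_apply, Matrix.mul_apply (M := Wᵀ), centering_mul_apply,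
    Matrix.transpose_apply]
  rw [← frobSq_transpose, frobSq, Finset.mul_sum, ← Finset.sum_sub_distrib]
  refine Finset.sum_congr rfl fun l _ => ?_
  simp only [mul_sub, Finset.sum_sub_distrib, ← Finset.sum_mul, Matrix.transpose_apply, sq]
  ring

lemma permMat_mulVec_apply {m : ℕ} (g : Equiv.Perm (Fin m)) (v : Fin m → ℝ) (i : Fin m) :
    (permMat g *ᵥ v) i = v (g.symm i) := by
  simp [permMat, Matrix.mulVec, dotProduct, ← Equiv.symm_apply_eq]

/-- Orbit second moments of a zero-sum vector under the symmetric group. -/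
lemma sum_perm_mul {m : ℕ} (hm : 2 ≤ m) (c : Fin m → ℝ) (hc : ∑ i, c i = 0) (i j : Fin m) :
    ∑ g : Equiv.Perm (Fin m), c (g.symm i) * c (g.symm j) =
      (m.factorial : ℝ) * (∑ i, c i ^ 2) / ((m : ℝ) - 1) * centering m i j := by
  have hm' : (2 : ℝ) ≤ m := by exact_mod_cast hm
  set F : Fin m → Fin m → ℝ := fun i j =>
    ∑ g : Equiv.Perm (Fin m), c (g.symm i) * c (g.symm j) with hF
  have hinv : ∀ (h : Equiv.Perm (Fin m)) i j, F (h i) (h j) = F i j := by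
    intro h i j
    simp only [hF]
    refine (Fintype.sum_equiv (Equiv.mulLeft h) _ _ fun g => ?_).symm
    simp [Equiv.Perm.mul_def]
  have hdiag : ∀ i, F i i = (m.factorial : ℝ) * (∑ i, c i ^ 2) / m := by
    intro i
    have h1 : ∑ l, F l l = (m : ℝ) * F i i := by
      rw [Finset.sum_congr rfl fun l _ => (by simpa using (hinv (Equiv.swap i l) i i) :
        F l l = F i i)]
      simp
    have h2 : ∑ l, F l l = (m.factorial : ℝ) * ∑ i, c i ^ 2 := by
      simp only [hF]
      rw [Finset.sum_comm, Finset.sum_congr rfl fun g _ =>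
        (Equiv.sum_comp g.symm fun l => c l * c l)]
      simp [Fintype.card_perm, sq]
    rw [eq_div_iff (by positivity), ← h2, h1, mul_comm]
  have hrow : ∀ i, ∑ l, F i l = 0 := by
    intro i
    simp only [hF]
    rw [Finset.sum_comm]
    refine Finset.sum_eq_zero fun g _ => ?_
    rw [← Finset.mul_sum, Equiv.sum_comp g.symm c, hc, mul_zero]
  change F i j = _
  by_cases hij : i = j
  · subst hij
    rw [hdiag, centering_apply, if_pos rfl]
    have : (m : ℝ) - 1 ≠ 0 := by linarith
    field_simp
  · have h1 : ∀ l ∈ Finset.univ.erase i, F i l = F i j := by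
      intro l hl
      have hl' := Finset.ne_of_mem_erase hl
      have := hinv (Equiv.swap j l) i j
      rwa [Equiv.swap_apply_left, Equiv.swap_apply_of_ne_of_ne hij (Ne.symm hl')] at this
    have h2 := hrow i
    rw [← Finset.add_sum_erase _ _ (Finset.mem_univ i), Finset.sum_congr rfl h1, hdiag,
      Finset.sum_const, Finset.card_erase_of_mem (Finset.mem_univ i), Finset.card_univ,
      Fintype.card_fin, nsmul_eq_mul, Nat.cast_sub (by omega), Nat.cast_one] at h2
    rw [centering_apply, if_neg hij]
    have : (m : ℝ) - 1 ≠ 0 := by linarith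
    have hm0 : (m : ℝ) ≠ 0 := by linarith
    field_simp at h2 ⊢
    linarith

lemma crossEnt_softmax {m : ℕ} (hm : 0 < m) (z p : Fin m → ℝ) (hp : ∑ i, p i = 1) :
    crossEnt (softmax z) p = Real.log (∑ i, Real.exp (z i)) - ∑ i, p i * z i := by
  have : Nonempty (Fin m) := ⟨⟨0, hm⟩⟩
  have hpos : 0 < ∑ i, Real.exp (z i) :=
    Finset.sum_pos (fun i _ => Real.exp_pos _) Finset.univ_nonempty
  have h : ∀ i, Real.log (softmax z i) = z i - Real.log (∑ i, Real.exp (z i)) := fun i => by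
    rw [softmax, Real.log_div (Real.exp_ne_zero _) hpos.ne', Real.log_exp]
  simp only [crossEnt, h, mul_sub, Finset.sum_sub_distrib, ← Finset.sum_mul, hp]
  ring

lemma softmax_log_add_const {m : ℕ} (z a : Fin m → ℝ) (ha : ∀ i, 0 < a i)
    (ha1 : ∑ i, a i = 1) (μ : ℝ) (hz : ∀ i, z i = Real.log (a i) + μ) : softmax z = a := by
  ext i
  have h : ∀ i, Real.exp (z i) = a i * Real.exp μ := fun i => by
    rw [hz, Real.exp_add, Real.exp_log (ha i)]
  simp only [softmax, h, ← Finset.sum_mul, ha1]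
  field_simp

/-- Convexity of the cross-entropy in the logits, around the logits of `a`. -/
lemma crossEnt_add_le {m : ℕ} (hm : 0 < m) (z a p : Fin m → ℝ) (ha : ∀ i, 0 < a i)
    (ha1 : ∑ i, a i = 1) (hp : ∑ i, p i = 1) :
    crossEnt a p + ∑ i, (a i - p i) * (z i - Real.log (a i)) ≤ crossEnt (softmax z) p ∧
    (crossEnt a p + ∑ i, (a i - p i) * (z i - Real.log (a i)) = crossEnt (softmax z) p →
      ∃ μ, ∀ i, z i = Real.log (a i) + μ) := by
  have : Nonempty (Fin m) := ⟨⟨0, hm⟩⟩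
  have hpos : 0 < ∑ i, Real.exp (z i) :=
    Finset.sum_pos (fun i _ => Real.exp_pos _) Finset.univ_nonempty
  set δ : Fin m → ℝ := fun i => z i - Real.log (a i) with hδ
  set μ : ℝ := ∑ i, a i * δ i with hμ
  have hexp : ∑ i, Real.exp (z i) = Real.exp μ * ∑ i, a i * Real.exp (δ i - μ) := by
    rw [Finset.mul_sum]
    refine Finset.sum_congr rfl fun i _ => ?_
    rw [mul_left_comm, ← Real.exp_add, show μ + (δ i - μ) = z i - Real.log (a i) by
      simp only [hδ]; ring, Real.exp_sub, Real.exp_log (ha i)]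
    field_simp [(ha i).ne']
  have hlin : ∑ i, a i * (δ i - μ + 1) = 1 := by
    simp only [mul_add, mul_sub, Finset.sum_add_distrib, Finset.sum_sub_distrib,
      ← Finset.sum_mul, ha1]
    rw [← hμ]; ring
  have hle : ∀ i ∈ Finset.univ, a i * (δ i - μ + 1) ≤ a i * Real.exp (δ i - μ) := fun i _ =>
    mul_le_mul_of_nonneg_left (Real.add_one_le_exp _) (ha i).le
  have hS : 1 ≤ ∑ i, a i * Real.exp (δ i - μ) := hlin ▸ Finset.sum_le_sum hle
  have hlog : Real.log (∑ i, Real.exp (z i)) =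
      μ + Real.log (∑ i, a i * Real.exp (δ i - μ)) := by
    rw [hexp, Real.log_mul (Real.exp_ne_zero _) (by linarith), Real.log_exp]
  have hrhs : crossEnt a p + ∑ i, (a i - p i) * (z i - Real.log (a i)) =
      μ - ∑ i, p i * z i := by
    simp only [crossEnt, hμ, hδ, ← Finset.sum_neg_distrib, ← Finset.sum_sub_distrib,
      ← Finset.sum_add_distrib]
    exact Finset.sum_congr rfl fun i _ => by ring
  rw [crossEnt_softmax hm z p hp, hrhs, hlog]
  refine ⟨by linarith [Real.log_nonneg hS], fun heq => ⟨μ, fun i => ?_⟩⟩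
  have hl0 : Real.log (∑ i, a i * Real.exp (δ i - μ)) = 0 := by linarith
  have hS1 : ∑ i, a i * Real.exp (δ i - μ) = 1 :=
    Real.eq_one_of_pos_of_log_eq_zero (by linarith) hl0
  have h := (Finset.sum_eq_sum_iff_of_le hle).1 (hlin.trans hS1.symm) i (Finset.mem_univ i)
  have h' := mul_left_cancel₀ (ha i).ne' h
  by_contra hne
  have : δ i - μ ≠ 0 := fun h0 => hne (by simp only [hδ] at h0; linarith)
  linarith [Real.add_one_lt_exp this]

/-- If a multiple of a zero-sum matrix `C` with `C * Cᵀ` a multiple of the centering projection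
satisfies the energy balance, it factors within the two Frobenius budgets. -/
lemma exists_factorization {m d : ℕ} {n : Type*} [Fintype n] (hm : 2 ≤ m) (hd : m ≤ d)
    (C : Matrix (Fin m) n ℝ) (hC0 : ∀ j, ∑ i, C i j = 0) {EW EH k g : ℝ}
    (hEW : 0 < EW) (hCC : C * Cᵀ = g • centering m)
    (hbal : k ^ 2 * (((m : ℝ) - 1) ^ 2 * g) = EW * EH) :
    ∃ (W : Matrix (Fin m) (Fin d) ℝ) (H : Matrix (Fin d) n ℝ),
      frobSq W ≤ EW ∧ frobSq H ≤ EH ∧ W * H = (-k) • C := by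
  have hm1 : (0 : ℝ) < (m : ℝ) - 1 := by
    have : (2 : ℝ) ≤ m := by exact_mod_cast hm
    linarith
  set E : Matrix (Fin m) (Fin d) ℝ := Matrix.of fun i l => if Fin.castLE hd i = l then 1 else 0
    with hE
  have hEE : E * Eᵀ = 1 := by
    ext i j
    simp [hE, Matrix.mul_apply, Matrix.one_apply, eq_comm]
  set w : ℝ := Real.sqrt (EW / ((m : ℝ) - 1)) with hw
  have hw2 : w ^ 2 = EW / ((m : ℝ) - 1) := Real.sq_sqrt (by positivity)
  have hwpos : 0 < w := Real.sqrt_pos.2 (by positivity)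
  have hPP : centering m * centering m = centering m :=
    centering_mul_of_sum_eq_zero _ (sum_centering (by omega))
  have hPC : centering m * C = C := centering_mul_of_sum_eq_zero _ hC0
  refine ⟨w • (centering m * E), (-(k / w)) • (Eᵀ * C), ?_, ?_, ?_⟩
  · rw [frobSq_smul, frobSq_eq_trace, Matrix.transpose_mul, centering_transpose,
      Matrix.mul_assoc, ← Matrix.mul_assoc E, hEE, Matrix.one_mul, hPP,
      trace_centering (by omega), hw2]
    apply le_of_eq
    field_simp
  · rw [frobSq_smul, ← frobSq_transpose, frobSq_eq_trace, Matrix.transpose_transpose,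
      Matrix.transpose_mul, Matrix.transpose_transpose, Matrix.mul_assoc, ← Matrix.mul_assoc E,
      hEE, Matrix.one_mul, Matrix.trace_mul_comm, hCC, Matrix.trace_smul,
      trace_centering (by omega), neg_sq, div_pow, hw2, smul_eq_mul]
    apply le_of_eq
    field_simp
    linarith
  · rw [Matrix.smul_mul, Matrix.mul_smul, Matrix.mul_assoc, ← Matrix.mul_assoc E, hEE,
      Matrix.one_mul, hPC, smul_smul]
    congr 1
    field_simp

/-- Equality case of the duality bound `-⟨C, W H⟩ ≤ ‖C‖ ‖W‖ ‖H‖`. -/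
lemma factors_of_inner_le {m d : ℕ} {n : Type*} [Fintype n] (hm : 2 ≤ m)
    (C : Matrix (Fin m) n ℝ) {EW EH k g : ℝ}
    (hEW : 0 < EW) (hk : 0 < k) (hg : 0 < g) (hCC : C * Cᵀ = g • centering m)
    (hbal : k ^ 2 * (((m : ℝ) - 1) ^ 2 * g) = EW * EH)
    (W : Matrix (Fin m) (Fin d) ℝ) (H : Matrix (Fin d) n ℝ)
    (hW : frobSq W ≤ EW) (hH : frobSq H ≤ EH)
    (hin : (W * H * Cᵀ).trace ≤ -(k * (((m : ℝ) - 1) * g))) :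
    (W * H * Cᵀ).trace = -(k * (((m : ℝ) - 1) * g)) ∧ (∀ l, ∑ i, W i l = 0) ∧
      H = -((k * ((m : ℝ) - 1) / EW) • (Wᵀ * C)) := by
  have hm1 : (0 : ℝ) < (m : ℝ) - 1 := by
    have : (2 : ℝ) ≤ m := by exact_mod_cast hm
    linarith
  have hm0 : (0 : ℝ) < m := by linarith
  set s : ℝ := k * ((m : ℝ) - 1) / EW with hs
  have hspos : 0 < s := by positivity
  have hWC : frobSq (Wᵀ * C) = g * (frobSq W - (1 / (m : ℝ)) * ∑ l, (∑ i, W i l) ^ 2) := by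
    rw [frobSq_eq_trace, Matrix.transpose_mul, Matrix.transpose_transpose, Matrix.mul_assoc,
      ← Matrix.mul_assoc C, hCC, Matrix.smul_mul, Matrix.mul_smul, Matrix.trace_smul,
      trace_centering_quadratic, smul_eq_mul]
  have htr : (H * (Wᵀ * C)ᵀ).trace = (W * H * Cᵀ).trace := by
    rw [Matrix.transpose_mul, Matrix.transpose_transpose, ← Matrix.mul_assoc,
      Matrix.trace_mul_comm, Matrix.mul_assoc]
  have hexp := frobSq_add_smul H (Wᵀ * C) s
  rw [htr, hWC] at hexp
  have hnn := frobSq_nonneg (H + s • (Wᵀ * C))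
  have hq : 0 ≤ ∑ l, (∑ i, W i l) ^ 2 := Finset.sum_nonneg fun _ _ => sq_nonneg _
  have e1 : s ^ 2 * (g * EW) = EH := by
    rw [hs]; field_simp; linarith
  have e2 : s * (k * (((m : ℝ) - 1) * g)) = EH := by
    rw [hs]; field_simp; linarith
  have hsg : 0 < s ^ 2 * g := by positivity
  have i1 := mul_le_mul_of_nonneg_left hW hsg.le
  have i2 := mul_le_mul_of_nonneg_left hin hspos.le
  have i3 : 0 ≤ s ^ 2 * g * ((1 / (m : ℝ)) * ∑ l, (∑ i, W i l) ^ 2) := by positivity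
  have hz : frobSq (H + s • (Wᵀ * C)) = 0 := by nlinarith
  have hz3 : s ^ 2 * g * ((1 / (m : ℝ)) * ∑ l, (∑ i, W i l) ^ 2) = 0 := by nlinarith
  have hz2 : s * (W * H * Cᵀ).trace = s * -(k * (((m : ℝ) - 1) * g)) := by nlinarith
  refine ⟨mul_left_cancel₀ hspos.ne' hz2, fun l => ?_,
    eq_neg_of_add_eq_zero_left (eq_zero_of_frobSq_eq_zero hz)⟩
  have hsum : ∑ l, (∑ i, W i l) ^ 2 = 0 := by
    have h := (mul_eq_zero.1 hz3).resolve_left hsg.ne'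
    exact (mul_eq_zero.1 h).resolve_left (by positivity)
  have h := (Finset.sum_eq_zero_iff_of_nonneg (fun l _ => sq_nonneg (∑ i, W i l))).1 hsum l
    (Finset.mem_univ l)
  simpa using h

/-- Structure of optimal embeddings for the symmetric group: every global minimizer
`(W*, H*)` satisfies `W*(W*)ᵀ = (E_W/(m−1))·(I_m − (1/m)1_m1_mᵀ)` (so the rows of `W*` form a
simplex equiangular tight frame, i.e. the Gram matrix is a positive multiple of
`I_m − (1/m)1_m1_mᵀ`), `(H*)ᵀH* = (E_H/((m−1)γ²))·CᵀC`, and `W*H* = −k·C`. -/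
theorem structure_optimal_embeddings_symmetric_group
    (m d : ℕ) (hm : 2 ≤ m) (hd : m ≤ d)
    (y : Fin m → ℝ) (hy : y ∈ stdSimplex ℝ (Fin m)) (hyn : y ≠ fun _ => 1 / (m : ℝ))
    (EW EH : ℝ) (hEW : 0 < EW) (hEH : 0 < EH)
    (Y : Matrix (Fin m) (Equiv.Perm (Fin m)) ℝ)
    (hY : ∀ g : Equiv.Perm (Fin m), (fun i => Y i g) = permMat g *ᵥ y)
    (hactive : ∀ (W : Matrix (Fin m) (Fin d) ℝ) (H : Matrix (Fin d) (Equiv.Perm (Fin m)) ℝ),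
      IsGlobalMin EW EH Y W H → frobSq W = EW ∧ frobSq H = EH)
    (α : Fin m → ℝ) (hα : α ∈ stdSimplex ℝ (Fin m)) (hαpos : ∀ i, 0 < α i)
    (k : ℝ)
    (hk : k = Real.sqrt (EW * EH /
      ((m.factorial : ℝ) * ((m : ℝ) - 1) * ∑ i, (α i - y i) ^ 2)))
    (hsys : ∀ i, k * (α i - y i) + Real.log (α i) = (1 / (m : ℝ)) * ∑ r, Real.log (α r))
    (A : Matrix (Fin m) (Equiv.Perm (Fin m)) ℝ)
    (hA : ∀ g : Equiv.Perm (Fin m), (fun i => A i g) = permMat g *ᵥ α)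
    (C : Matrix (Fin m) (Equiv.Perm (Fin m)) ℝ) (hCdef : C = A - Y)
    (γ : ℝ)
    (hγ : γ = Real.sqrt ((m.factorial : ℝ) / ((m : ℝ) - 1)) *
      Real.sqrt (∑ i, (α i - y i) ^ 2))
    (W : Matrix (Fin m) (Fin d) ℝ) (H : Matrix (Fin d) (Equiv.Perm (Fin m)) ℝ)
    (hmin : IsGlobalMin EW EH Y W H) :
    W * Wᵀ = (EW / ((m : ℝ) - 1)) •
        ((1 : Matrix (Fin m) (Fin m) ℝ) - ((1 : ℝ) / (m : ℝ)) • Matrix.of (fun _ _ => (1 : ℝ))) ∧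
    (∃ c : ℝ, 0 < c ∧ W * Wᵀ = c •
        ((1 : Matrix (Fin m) (Fin m) ℝ) - ((1 : ℝ) / (m : ℝ)) • Matrix.of (fun _ _ => (1 : ℝ)))) ∧
    Hᵀ * H = (EH / (((m : ℝ) - 1) * γ ^ 2)) • (Cᵀ * C) ∧
    W * H = (-k) • C := by
  have hm1 : (0 : ℝ) < (m : ℝ) - 1 := by
    have : (2 : ℝ) ≤ m := by exact_mod_cast hm
    linarith
  have hmpos : 0 < m := by omega
  have hm0 : (m : ℝ) ≠ 0 := by positivity
  have hYap : ∀ i g, Y i g = y (g.symm i) := fun i g =>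
    (congrFun (hY g) i).trans (permMat_mulVec_apply g y i)
  have hAap : ∀ i g, A i g = α (g.symm i) := fun i g =>
    (congrFun (hA g) i).trans (permMat_mulVec_apply g α i)
  set c : Fin m → ℝ := fun i => α i - y i with hc
  set N : ℝ := ∑ i, (α i - y i) ^ 2 with hN
  set κ : ℝ := (1 / (m : ℝ)) * ∑ r, Real.log (α r) with hκ
  have hCap : ∀ i g, C i g = c (g.symm i) := fun i g => by
    rw [hCdef, Matrix.sub_apply, hYap, hAap]
  have hcsum : ∑ i, c i = 0 := by simp [hc, Finset.sum_sub_distrib, hα.2, hy.2]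
  have hC0 : ∀ g, ∑ i, C i g = 0 := fun g => by
    simp only [hCap]
    rw [Equiv.sum_comp g.symm c, hcsum]
  have hNpos : 0 < N := by
    refine lt_of_le_of_ne (Finset.sum_nonneg fun i _ => sq_nonneg _) fun h0 => hyn ?_
    have hay : ∀ i, α i = y i := fun i => by
      have := (Finset.sum_eq_zero_iff_of_nonneg (fun i _ => sq_nonneg (α i - y i))).1 h0.symm i
        (Finset.mem_univ i)
      exact sub_eq_zero.1 (by simpa using this)
    have hexp : ∀ i, α i = Real.exp κ := fun i => by
      rw [← hsys i, hay i, sub_self, mul_zero, zero_add, ← hay i, Real.exp_log (hαpos i)]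
    have h1 := hα.2
    rw [Finset.sum_congr rfl fun i _ => hexp i] at h1
    simp only [Finset.sum_const, Finset.card_univ, Fintype.card_fin, nsmul_eq_mul] at h1
    ext i
    rw [← hay, hexp, eq_div_iff hm0, mul_comm, h1]
  have hfac : (0 : ℝ) < m.factorial := by exact_mod_cast m.factorial_pos
  have hkpos : 0 < k := by rw [hk]; exact Real.sqrt_pos.2 (by positivity)
  have hk2 : k ^ 2 = EW * EH / ((m.factorial : ℝ) * ((m : ℝ) - 1) * N) := by
    rw [hk]; exact Real.sq_sqrt (by positivity)
  have hγ2 : γ ^ 2 = (m.factorial : ℝ) * N / ((m : ℝ) - 1) := by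
    rw [hγ, mul_pow, Real.sq_sqrt (by positivity), Real.sq_sqrt hNpos.le]
    ring
  have hγpos : 0 < γ ^ 2 := by rw [hγ2]; positivity
  have hCC : C * Cᵀ = γ ^ 2 • centering m := by
    ext i j
    simp only [Matrix.mul_apply, Matrix.transpose_apply, hCap, Matrix.smul_apply, smul_eq_mul]
    rw [sum_perm_mul hm c hcsum, hγ2]
  have hbal : k ^ 2 * (((m : ℝ) - 1) ^ 2 * γ ^ 2) = EW * EH := by
    rw [hk2, hγ2]; field_simp
  have htrCC : (C * Cᵀ).trace = ((m : ℝ) - 1) * γ ^ 2 := by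
    rw [hCC, Matrix.trace_smul, trace_centering hmpos, smul_eq_mul, mul_comm]
  have hlogA : ∀ i g, Real.log (A i g) = -k * C i g + κ := fun i g => by
    rw [hAap, hCap, ← hsys (g.symm i)]; ring
  have hApos : ∀ g i, 0 < A i g := fun g i => by rw [hAap]; exact hαpos _
  have hA1 : ∀ g, ∑ i, A i g = 1 := fun g => by
    simp only [hAap]; rw [Equiv.sum_comp g.symm α, hα.2]
  have hY1 : ∀ g, ∑ i, Y i g = 1 := fun g => by
    simp only [hYap]; rw [Equiv.sum_comp g.symm y, hy.2]
  obtain ⟨W₀, H₀, hW₀, hH₀, hWH₀⟩ := exists_factorization hm hd C hC0 hEW hCC hbal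
  have hJ₀ : lpObj W₀ H₀ Y = ∑ g, crossEnt (fun i => A i g) (fun i => Y i g) := by
    refine Finset.sum_congr rfl fun g _ => ?_
    rw [softmax_log_add_const (fun i => (W₀ * H₀) i g) (fun i => A i g) (hApos g) (hA1 g) (-κ)]
    intro i
    simp [hWH₀, hlogA]
  obtain ⟨hW, hH, hopt⟩ := hmin
  have hJ := (hopt W₀ H₀ hW₀ hH₀).trans_eq hJ₀
  have hconv := fun g => crossEnt_add_le hmpos (fun i => (W * H) i g) (fun i => A i g)
    (fun i => Y i g) (hApos g) (hA1 g) (hY1 g)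
  have hlin : ∑ g, ∑ i, (A i g - Y i g) * ((W * H) i g - Real.log (A i g)) =
      (W * H * Cᵀ).trace + k * (((m : ℝ) - 1) * γ ^ 2) := by
    have hg : ∀ g, ∑ i, (A i g - Y i g) * ((W * H) i g - Real.log (A i g)) =
        ∑ i, ((W * H) i g * C i g + k * (C i g * C i g)) := fun g => by
      have h : ∀ i, (A i g - Y i g) * ((W * H) i g - Real.log (A i g)) =
          ((W * H) i g * C i g + k * (C i g * C i g)) - C i g * κ := fun i => by
        rw [hlogA, hCdef, Matrix.sub_apply]; ring
      rw [Finset.sum_congr rfl fun i _ => h i, Finset.sum_sub_distrib, ← Finset.sum_mul, hC0]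
      ring
    rw [Finset.sum_congr rfl fun g _ => hg g, Finset.sum_comm, ← htrCC]
    simp only [Matrix.trace, Matrix.diag_apply, Matrix.mul_apply (N := Cᵀ), Matrix.transpose_apply,
      Finset.sum_add_distrib, Finset.mul_sum]
  have hlower : ∑ g, (crossEnt (fun i => A i g) (fun i => Y i g) +
      ∑ i, (A i g - Y i g) * ((W * H) i g - Real.log (A i g))) ≤ lpObj W H Y :=
    Finset.sum_le_sum fun g _ => (hconv g).1
  have hlower' := hlower
  rw [Finset.sum_add_distrib, hlin] at hlower'
  obtain ⟨htr, hW0, hHW⟩ := factors_of_inner_le hm C hEW hkpos hγpos hCC hbal W H hW hH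
    (by linarith)
  have heq : ∑ g, (crossEnt (fun i => A i g) (fun i => Y i g) +
      ∑ i, (A i g - Y i g) * ((W * H) i g - Real.log (A i g))) = lpObj W H Y := by
    refine le_antisymm hlower ?_
    rw [Finset.sum_add_distrib, hlin, htr]
    linarith
  have hWH : W * H = (-k) • C := by
    ext i g
    obtain ⟨μ, hμ⟩ := (hconv g).2
      ((Finset.sum_eq_sum_iff_of_le fun g _ => (hconv g).1).1 heq g (Finset.mem_univ g))
    simp only [hlogA] at hμ
    have hsum : ∑ i, (W * H) i g = 0 := by
      simp only [Matrix.mul_apply]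
      rw [Finset.sum_comm]
      exact Finset.sum_eq_zero fun l _ => by rw [← Finset.sum_mul, hW0, zero_mul]
    rw [Finset.sum_congr rfl fun i _ => hμ i] at hsum
    simp only [Finset.sum_add_distrib, ← Finset.mul_sum, hC0, Finset.sum_const,
      Finset.card_univ, Fintype.card_fin, nsmul_eq_mul, mul_zero, zero_add, ← mul_add] at hsum
    have hκμ := (mul_eq_zero.1 hsum).resolve_left hm0
    rw [hμ i, Matrix.smul_apply, smul_eq_mul]
    linarith
  set s : ℝ := k * ((m : ℝ) - 1) / EW with hs
  have hspos : 0 < s := by positivity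
  have hsk : k / s = EW / ((m : ℝ) - 1) := by rw [hs]; field_simp
  have hWWC : W * Wᵀ * C = (k / s) • C := by
    have h := hWH
    rw [hHW, Matrix.mul_neg, Matrix.mul_smul, neg_smul, neg_inj, ← Matrix.mul_assoc] at h
    rw [div_eq_inv_mul, mul_smul, ← h, smul_smul, inv_mul_cancel₀ hspos.ne', one_smul]
  have hWW : W * Wᵀ = (EW / ((m : ℝ) - 1)) • centering m := by
    have h := congrArg (fun B => B * Cᵀ) hWWC
    simp only [Matrix.mul_assoc, Matrix.smul_mul, hCC, Matrix.mul_smul] at h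
    rw [smul_comm (k / s), hsk] at h
    have hPW : Wᵀ * centering m = Wᵀ := by
      have h := congrArg Matrix.transpose (centering_mul_of_sum_eq_zero W hW0)
      rwa [Matrix.transpose_mul, centering_transpose] at h
    rw [hPW] at h
    exact smul_right_injective _ hγpos.ne' h
  refine ⟨hWW, ⟨_, div_pos hEW hm1, hWW⟩, ?_, hWH⟩
  have hHH : Hᵀ * H = (s * k) • (Cᵀ * C) := by
    rw [hHW, Matrix.transpose_neg, Matrix.neg_mul, Matrix.mul_neg, neg_neg, Matrix.transpose_smul,
      Matrix.transpose_mul, Matrix.transpose_transpose, Matrix.smul_mul, Matrix.mul_smul,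
      Matrix.mul_assoc, ← Matrix.mul_assoc W, hWWC, Matrix.mul_smul, smul_smul, smul_smul]
    congr 1
    field_simp
  rw [hHH]
  congr 1
  rw [hs, eq_div_iff (by positivity)]
  field_simp
  linarith
end

section
/- Let m ≥ 2, let G be a finite 2-transitive permutation group on {1,…,m}, let y ∈ Δ^{m−1} be nonuniform, and let Y ∈ ℝ^{m×|G|} have columns {g ∘ y : g ∈ G} under a fixed enumeration of G. Fix E_W, E_H > 0 and d ≥ m, and assume the active-constraints condition. Let α ∈ Δ^{m−1} be the unique solution of k(α_i − y_i) + log α_i = (1/m)Σ_r log α_r, Σ_i α_i = 1, with k = √(E_W E_H/(|G|(m−1)Σ_i(α_i − y_i)²)); let A = [g ∘ α]_{g∈G} (same enumeration), C = A − Y, with rank-(m−1) SVD C = U(γI_{m−1})Vᵀ where γ = √(|G|/(m−1))·‖α − y‖₂. Then (W*, H*) is a global minimizer of the constrained layer-peeled problem if and only if W* = √(E_W/(m−1)) U Qᵀ and H* = −√(E_H/(m−1)) Q Vᵀ for some Q ∈ ℝ^{d×(m−1)} with QᵀQ = I_{m−1}. Moreover, every minimizer satisfies W*(W*)ᵀ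 = (E_W/(m−1))·(I_m − (1/m)1_m1_mᵀ), (H*)ᵀH* = (E_H/((m−1)γ²))·CᵀC, and W*H* = −k·C. -/
open scoped BigOperators
open Matrix

/-- A permutation group on `{1,…,m}` is 2-transitive if any ordered pair of distinct indices
can be mapped to any other ordered pair of distinct indices by some group element. -/
def IsTwoTransitive {m : ℕ} (G : Subgroup (Equiv.Perm (Fin m))) : Prop :=
  ∀ x1 x2 y1 y2 : Fin m, x1 ≠ x2 → y1 ≠ y2 → ∃ g ∈ G, g x1 = y1 ∧ g x2 = y2

lemma softmax_pos {m : ℕ} [NeZero m] (u : Fin m → ℝ) (i : Fin m) : 0 < softmax u i :=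
  div_pos (Real.exp_pos _) (Finset.sum_pos (fun _ _ => Real.exp_pos _) Finset.univ_nonempty)

lemma sum_softmax {m : ℕ} [NeZero m] (u : Fin m → ℝ) : ∑ i, softmax u i = 1 := by
  have h : (0 : ℝ) < ∑ k, Real.exp (u k) :=
    Finset.sum_pos (fun _ _ => Real.exp_pos _) Finset.univ_nonempty
  simp only [softmax, ← Finset.sum_div]
  exact div_self h.ne'

lemma log_softmax {m : ℕ} [NeZero m] (u : Fin m → ℝ) (i : Fin m) :
    Real.log (softmax u i) = u i - Real.log (∑ k, Real.exp (u k)) := by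
  have h : (0 : ℝ) < ∑ k, Real.exp (u k) :=
    Finset.sum_pos (fun _ _ => Real.exp_pos _) Finset.univ_nonempty
  rw [softmax, Real.log_div (Real.exp_pos _).ne' h.ne', Real.log_exp]

/-- A vector of the simplex whose logarithm is `u` up to an additive constant is `softmax u`. -/
lemma softmax_eq_of_log {m : ℕ} {a u : Fin m → ℝ} {c : ℝ} (ha : ∀ i, 0 < a i)
    (hsum : ∑ i, a i = 1) (h : ∀ i, Real.log (a i) = u i + c) : softmax u = a := by
  have hu : ∀ i, Real.exp (u i) = a i * Real.exp (-c) := fun i => by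
    rw [← Real.exp_log (ha i), ← Real.exp_add, h i]
    ring_nf
  funext i
  simp only [softmax, hu]
  rw [← Finset.sum_mul, hsum, one_mul, mul_div_assoc, div_self (Real.exp_pos _).ne', mul_one]

lemma sub_le_mul_log_sub_log {a b : ℝ} (ha : 0 < a) (hb : 0 < b) :
    a - b ≤ a * (Real.log a - Real.log b) := by
  have h1 := Real.log_le_sub_one_of_pos (div_pos hb ha)
  rw [Real.log_div hb.ne' ha.ne'] at h1
  have h2 := mul_le_mul_of_nonneg_left h1 ha.le
  rw [mul_sub, mul_sub, mul_div_cancel₀ _ ha.ne'] at h2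
  linarith

/-- Gibbs' inequality. -/
lemma sum_mul_log_sub_log_nonneg {ι : Type*} [Fintype ι] {a b : ι → ℝ} (ha : ∀ i, 0 < a i)
    (hb : ∀ i, 0 < b i) (hab : ∑ i, a i = ∑ i, b i) :
    0 ≤ ∑ i, a i * (Real.log (a i) - Real.log (b i)) := by
  have := Finset.sum_le_sum fun i (_ : i ∈ Finset.univ) =>
    sub_le_mul_log_sub_log (ha i) (hb i)
  rw [Finset.sum_sub_distrib, hab, sub_self] at this
  exact this

/-- The equality case of Gibbs' inequality. -/
lemma eq_of_sum_mul_log_sub_log_nonpos {ι : Type*} [Fintype ι] {a b : ι → ℝ}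
    (ha : ∀ i, 0 < a i) (hb : ∀ i, 0 < b i) (hab : ∑ i, a i = ∑ i, b i)
    (h : ∑ i, a i * (Real.log (a i) - Real.log (b i)) ≤ 0) : a = b := by
  by_contra hne
  obtain ⟨j, hj⟩ := Function.ne_iff.mp hne
  have hlt : a j - b j < a j * (Real.log (a j) - Real.log (b j)) := by
    have h1 := Real.log_lt_sub_one_of_pos (div_pos (hb j) (ha j))
      (fun h => hj ((div_eq_one_iff_eq (ha j).ne').mp h).symm)
    rw [Real.log_div (hb j).ne' (ha j).ne'] at h1
    have h2 := mul_lt_mul_of_pos_left h1 (ha j)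
    rw [mul_sub, mul_sub, mul_div_cancel₀ _ (ha j).ne'] at h2
    linarith
  have := Finset.sum_lt_sum
    (fun i (_ : i ∈ Finset.univ) => sub_le_mul_log_sub_log (ha i) (hb i)) ⟨j, Finset.mem_univ j, hlt⟩
  rw [Finset.sum_sub_distrib, hab, sub_self] at this
  linarith

/-- First-order expansion of the softmax cross-entropy, with a relative entropy as remainder. -/
lemma crossEnt_softmax_sub {m : ℕ} [NeZero m] {p : Fin m → ℝ} (hp : ∑ i, p i = 1)
    (z w : Fin m → ℝ) :
    crossEnt (softmax z) p - crossEnt (softmax w) p =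
      ∑ i, (softmax w i - p i) * (z i - w i) +
        ∑ i, softmax w i * (Real.log (softmax w i) - Real.log (softmax z i)) := by
  set c := Real.log (∑ k, Real.exp (z k)) - Real.log (∑ k, Real.exp (w k)) with hc
  have h0 : ∑ i, (softmax w i - p i) * c = 0 := by
    rw [← Finset.sum_mul, Finset.sum_sub_distrib, sum_softmax, hp]
    ring
  have h1 : ∑ i, (softmax w i - p i) * (z i - w i) =
      ∑ i, ((softmax w i - p i) * (Real.log (softmax z i) - Real.log (softmax w i)) +
        (softmax w i - p i) * c) := by
    refine Finset.sum_congr rfl fun i _ => ?_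
    rw [log_softmax, log_softmax, hc]
    ring
  rw [h1, Finset.sum_add_distrib, h0, add_zero, ← Finset.sum_add_distrib, crossEnt, crossEnt,
    neg_sub_neg, ← Finset.sum_sub_distrib]
  exact Finset.sum_congr rfl fun i _ => by ring

lemma crossEnt_softmax_ge {m : ℕ} [NeZero m] {p : Fin m → ℝ} (hp : ∑ i, p i = 1)
    (z w : Fin m → ℝ) :
    crossEnt (softmax w) p + ∑ i, (softmax w i - p i) * (z i - w i) ≤ crossEnt (softmax z) p := by
  have h := crossEnt_softmax_sub hp z w
  have := sum_mul_log_sub_log_nonneg (softmax_pos w) (softmax_pos z)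
    ((sum_softmax w).trans (sum_softmax z).symm)
  linarith

lemma eq_of_crossEnt_softmax_le {m : ℕ} [NeZero m] {p : Fin m → ℝ} (hp : ∑ i, p i = 1)
    {z w : Fin m → ℝ} (hzw : ∑ i, z i = ∑ i, w i)
    (h : crossEnt (softmax z) p ≤
      crossEnt (softmax w) p + ∑ i, (softmax w i - p i) * (z i - w i)) : z = w := by
  have h1 := crossEnt_softmax_sub hp z w
  have h2 := eq_of_sum_mul_log_sub_log_nonpos (softmax_pos w) (softmax_pos z)
    ((sum_softmax w).trans (sum_softmax z).symm) (by linarith)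
  set c := Real.log (∑ k, Real.exp (z k)) - Real.log (∑ k, Real.exp (w k)) with hc
  have h3 : ∀ i, z i = w i + c := fun i => by
    have h4 := log_softmax z i
    rw [← h2, log_softmax] at h4
    rw [hc]
    linarith
  have h5 : (m : ℝ) * c = 0 := by
    simp only [h3, Finset.sum_add_distrib, Finset.sum_const, Finset.card_univ, Fintype.card_fin,
      nsmul_eq_mul] at hzw
    linarith
  have h6 : c = 0 := (mul_eq_zero.mp h5).resolve_left (Nat.cast_ne_zero.mpr (NeZero.ne m))
  funext i
  rw [h3, h6, add_zero]

section Frobenius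

variable {ι κ δ ν : Type*} [Fintype ι] [Fintype κ] [Fintype δ] [Fintype ν]

lemma frobSq_nonneg_s17 (M : Matrix ι κ ℝ) : 0 ≤ frobSq M :=
  Finset.sum_nonneg fun _ _ => Finset.sum_nonneg fun _ _ => sq_nonneg _

lemma frobSq_transpose_s17 (M : Matrix ι κ ℝ) : frobSq Mᵀ = frobSq M :=
  Finset.sum_comm

lemma trace_transpose_mul_eq_sum (M N : Matrix ι κ ℝ) :
    (Mᵀ * N).trace = ∑ j, ∑ i, M i j * N i j := by
  simp [Matrix.trace, Matrix.mul_apply]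

lemma frobSq_eq_trace_s17 (M : Matrix ι κ ℝ) : frobSq M = (Mᵀ * M).trace := by
  rw [trace_transpose_mul_eq_sum, Finset.sum_comm]
  simp only [frobSq, sq]

lemma eq_zero_of_frobSq_nonpos {M : Matrix ι κ ℝ} (h : frobSq M ≤ 0) : M = 0 := by
  have h0 : ∑ i, ∑ j, (M i j) ^ 2 = 0 := le_antisymm h (frobSq_nonneg_s17 M)
  ext i j
  have h1 := (Finset.sum_eq_zero_iff_of_nonneg fun i _ =>
    Finset.sum_nonneg fun j _ => sq_nonneg (M i j)).mp h0 i (Finset.mem_univ i)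
  have h2 := (Finset.sum_eq_zero_iff_of_nonneg fun j _ => sq_nonneg (M i j)).mp h1 j
    (Finset.mem_univ j)
  simpa using h2

lemma frobSq_smul_s17 (c : ℝ) (M : Matrix ι κ ℝ) : frobSq (c • M) = c ^ 2 * frobSq M := by
  simp only [frobSq, Matrix.smul_apply, smul_eq_mul, mul_pow, Finset.mul_sum]

lemma frobSq_add (M N : Matrix ι κ ℝ) :
    frobSq (M + N) = frobSq M + frobSq N + 2 * (Mᵀ * N).trace := by
  have h : (Nᵀ * M).trace = (Mᵀ * N).trace := by
    rw [← Matrix.trace_transpose, Matrix.transpose_mul, Matrix.transpose_transpose]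
  rw [frobSq_eq_trace_s17, frobSq_eq_trace_s17, frobSq_eq_trace_s17, Matrix.transpose_add,
    Matrix.add_mul, Matrix.mul_add, Matrix.mul_add, Matrix.trace_add, Matrix.trace_add, Matrix.trace_add, h]
  ring

variable [DecidableEq κ]

lemma frobSq_mul_of_orthonormal {U : Matrix ι κ ℝ} (hU : Uᵀ * U = 1) (P : Matrix κ δ ℝ) :
    frobSq (U * P) = frobSq P := by
  rw [frobSq_eq_trace_s17, frobSq_eq_trace_s17, Matrix.transpose_mul, Matrix.mul_assoc,
    ← Matrix.mul_assoc Uᵀ, hU, Matrix.one_mul]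

lemma frobSq_of_orthonormal {U : Matrix ι κ ℝ} (hU : Uᵀ * U = 1) :
    frobSq U = Fintype.card κ := by
  rw [frobSq_eq_trace_s17, hU, Matrix.trace_one]

/-- Pythagoras for the orthogonal projection onto the range of `U`. -/
lemma frobSq_eq_add_of_orthonormal {U : Matrix ι κ ℝ} (hU : Uᵀ * U = 1) (W : Matrix ι δ ℝ) :
    frobSq W = frobSq (Uᵀ * W) + frobSq (W - U * (Uᵀ * W)) := by
  have h := frobSq_add (U * (Uᵀ * W)) (W - U * (Uᵀ * W))
  have h0 : (U * (Uᵀ * W))ᵀ * (W - U * (Uᵀ * W)) = 0 := by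
    rw [Matrix.transpose_mul, Matrix.mul_assoc, Matrix.mul_sub, ← Matrix.mul_assoc Uᵀ U, hU,
      Matrix.one_mul, sub_self, Matrix.mul_zero]
  rw [add_sub_cancel, frobSq_mul_of_orthonormal hU, h0, Matrix.trace_zero, mul_zero, add_zero] at h
  exact h

lemma two_mul_trace_add_eq {U : Matrix ι κ ℝ} {V : Matrix ν κ ℝ} (hU : Uᵀ * U = 1)
    (hV : Vᵀ * V = 1) (a b : ℝ) (W : Matrix ι δ ℝ) (K : Matrix ν δ ℝ) :
    2 * (a * b) * (((Uᵀ * W)ᵀ * (Vᵀ * K)).trace + a * b) =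
      frobSq (b • (Uᵀ * W) + a • (Vᵀ * K)) + b ^ 2 * (a ^ 2 - frobSq W) +
        b ^ 2 * frobSq (W - U * (Uᵀ * W)) + a ^ 2 * (b ^ 2 - frobSq K) +
        a ^ 2 * frobSq (K - V * (Vᵀ * K)) := by
  rw [frobSq_eq_add_of_orthonormal hU W, frobSq_eq_add_of_orthonormal hV K, frobSq_add,
    frobSq_smul_s17, frobSq_smul_s17, Matrix.transpose_smul, Matrix.smul_mul, Matrix.mul_smul,
    Matrix.trace_smul, Matrix.trace_smul, smul_eq_mul, smul_eq_mul]
  ring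

lemma neg_mul_le_trace_of_orthonormal {U : Matrix ι κ ℝ} {V : Matrix ν κ ℝ} (hU : Uᵀ * U = 1)
    (hV : Vᵀ * V = 1) {a b : ℝ} (ha : 0 < a) (hb : 0 < b) {W : Matrix ι δ ℝ} {K : Matrix ν δ ℝ}
    (hW : frobSq W ≤ a ^ 2) (hK : frobSq K ≤ b ^ 2) :
    -(a * b) ≤ ((Uᵀ * W)ᵀ * (Vᵀ * K)).trace := by
  have h := two_mul_trace_add_eq hU hV a b W K
  have h1 := frobSq_nonneg_s17 (b • (Uᵀ * W) + a • (Vᵀ * K))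
  have h2 := mul_nonneg (sq_nonneg b) (sub_nonneg.mpr hW)
  have h3 := mul_nonneg (sq_nonneg b) (frobSq_nonneg_s17 (W - U * (Uᵀ * W)))
  have h4 := mul_nonneg (sq_nonneg a) (sub_nonneg.mpr hK)
  have h5 := mul_nonneg (sq_nonneg a) (frobSq_nonneg_s17 (K - V * (Vᵀ * K)))
  have h6 : 0 ≤ ((Uᵀ * W)ᵀ * (Vᵀ * K)).trace + a * b :=
    nonneg_of_mul_nonneg_right (by rw [h]; positivity) (by positivity : 0 < 2 * (a * b))
  linarith

lemma eq_of_trace_le_neg_mul {U : Matrix ι κ ℝ} {V : Matrix ν κ ℝ} (hU : Uᵀ * U = 1)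
    (hV : Vᵀ * V = 1) {a b : ℝ} (ha : 0 < a) (hb : 0 < b) {W : Matrix ι δ ℝ} {K : Matrix ν δ ℝ}
    (hW : frobSq W ≤ a ^ 2) (hK : frobSq K ≤ b ^ 2)
    (htr : ((Uᵀ * W)ᵀ * (Vᵀ * K)).trace ≤ -(a * b)) :
    W = U * (Uᵀ * W) ∧ K = V * (Vᵀ * K) ∧ b • (Uᵀ * W) + a • (Vᵀ * K) = 0 := by
  have h := two_mul_trace_add_eq hU hV a b W K
  have h1 := frobSq_nonneg_s17 (b • (Uᵀ * W) + a • (Vᵀ * K))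
  have h2 := mul_nonneg (sq_nonneg b) (sub_nonneg.mpr hW)
  have h3 := mul_nonneg (sq_nonneg b) (frobSq_nonneg_s17 (W - U * (Uᵀ * W)))
  have h4 := mul_nonneg (sq_nonneg a) (sub_nonneg.mpr hK)
  have h5 := mul_nonneg (sq_nonneg a) (frobSq_nonneg_s17 (K - V * (Vᵀ * K)))
  have h6 : 2 * (a * b) * (((Uᵀ * W)ᵀ * (Vᵀ * K)).trace + a * b) ≤ 0 :=
    mul_nonpos_of_nonneg_of_nonpos (by positivity) (by linarith)
  refine ⟨sub_eq_zero.mp (eq_zero_of_frobSq_nonpos ?_),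
    sub_eq_zero.mp (eq_zero_of_frobSq_nonpos ?_), eq_zero_of_frobSq_nonpos (by linarith)⟩
  · exact nonpos_of_mul_nonpos_right (by linarith : b ^ 2 * _ ≤ 0) (by positivity)
  · exact nonpos_of_mul_nonpos_right (by linarith : a ^ 2 * _ ≤ 0) (by positivity)

end Frobenius

/-- An `m × (m - 1)` matrix with orthonormal columns of zero sum projects onto the orthogonal
complement of the constant vectors. -/
lemma mul_transpose_eq_centering {m : ℕ} [NeZero m] {U : Matrix (Fin m) (Fin (m - 1)) ℝ}
    (hU : Uᵀ * U = 1) (hU0 : ∀ j, ∑ i, U i j = 0) :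
    U * Uᵀ = (1 : Matrix (Fin m) (Fin m) ℝ) -
      ((1 : ℝ) / (m : ℝ)) • Matrix.of (fun _ _ => (1 : ℝ)) := by
  set E : Matrix (Fin m) (Fin m) ℝ := ((1 : ℝ) / (m : ℝ)) • Matrix.of (fun _ _ => (1 : ℝ)) with hE
  have hm0 : (m : ℝ) ≠ 0 := Nat.cast_ne_zero.mpr (NeZero.ne m)
  have hEt : Eᵀ = E := by
    ext i j
    simp [hE]
  have hEE : E * E = E := by
    ext i j
    simp [hE, Matrix.mul_apply]
    field_simp
  have hEU : E * U = 0 := by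
    ext i j
    simp [hE, Matrix.mul_apply, ← Finset.mul_sum, hU0]
  have hUE : Uᵀ * E = 0 := by
    rw [← Matrix.transpose_transpose (Uᵀ * E), Matrix.transpose_mul, hEt,
      Matrix.transpose_transpose, hEU, Matrix.transpose_zero]
  have hPP : U * Uᵀ * (U * Uᵀ) = U * Uᵀ := by
    rw [Matrix.mul_assoc, ← Matrix.mul_assoc Uᵀ, hU, Matrix.one_mul]
  have hPE : U * Uᵀ * E = 0 := by rw [Matrix.mul_assoc, hUE, Matrix.mul_zero]
  have hEP : E * (U * Uᵀ) = 0 := by rw [← Matrix.mul_assoc, hEU, Matrix.zero_mul]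
  have htE : E.trace = 1 := by
    simp [hE, Matrix.trace, hm0]
  have htU : (U * Uᵀ).trace = (m : ℝ) - 1 := by
    rw [Matrix.trace_mul_comm, hU, Matrix.trace_one, Fintype.card_fin,
      Nat.cast_sub (NeZero.one_le), Nat.cast_one]
  have hN : frobSq (1 - E - U * Uᵀ) ≤ 0 := by
    have hidem : (1 - E - U * Uᵀ)ᵀ * (1 - E - U * Uᵀ) = 1 - E - U * Uᵀ := by
      rw [Matrix.transpose_sub, Matrix.transpose_sub, Matrix.transpose_mul,
        Matrix.transpose_transpose, Matrix.transpose_one, hEt]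
      simp only [sub_mul, mul_sub, Matrix.one_mul, Matrix.mul_one, hPP, hPE, hEP, hEE]
      abel
    rw [frobSq_eq_trace_s17, hidem, Matrix.trace_sub, Matrix.trace_sub, Matrix.trace_one, htE, htU,
      Fintype.card_fin, sub_self]
  exact (sub_eq_zero.mp (eq_zero_of_frobSq_nonpos hN)).symm

lemma exists_orthonormal_columns {r d : ℕ} (h : r ≤ d) :
    ∃ Q : Matrix (Fin d) (Fin r) ℝ, Qᵀ * Q = 1 := by
  refine ⟨(1 : Matrix (Fin d) (Fin d) ℝ).submatrix id (Fin.castLE h), ?_⟩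
  rw [Matrix.transpose_submatrix, Matrix.transpose_one,
    ← Matrix.submatrix_mul _ _ _ _ _ Function.bijective_id, Matrix.mul_one,
    Matrix.submatrix_one _ (Fin.castLE_injective h)]

lemma permMat_mulVec {m : ℕ} (g : Equiv.Perm (Fin m)) (v : Fin m → ℝ) (i : Fin m) :
    (permMat g *ᵥ v) i = v (g⁻¹ i) := by
  have h : ∀ j, (i = g j) ↔ (g⁻¹ i = j) := fun j => by
    rw [Equiv.Perm.inv_eq_iff_eq]
  simp [permMat, Matrix.mulVec, dotProduct, h]

/-- Optimal embeddings and their structure for 2-transitive groups: for the `G`-orbit target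
of a nonuniform `y`, with `α` solving the closed system, `C = A − Y` with rank-`(m−1)` SVD
`C = γ·U Vᵀ`, under the active-constraints assumption, `(W, H)` is a global minimizer iff
`W = √(E_W/(m−1))·U Qᵀ` and `H = −√(E_H/(m−1))·Q Vᵀ` with `QᵀQ = I_{m−1}`; moreover every
minimizer satisfies `W Wᵀ = (E_W/(m−1))(I_m − (1/m)1_m1_mᵀ)`, `HᵀH = (E_H/((m−1)γ²))·CᵀC`,
and `WH = −k·C`. -/
theorem optimal_embeddings_two_transitive
    (m d : ℕ) (hm : 2 ≤ m) (hd : m ≤ d)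
    (G : Subgroup (Equiv.Perm (Fin m))) [Fintype G] (hG : IsTwoTransitive G)
    (y : Fin m → ℝ) (hy : y ∈ stdSimplex ℝ (Fin m)) (hyn : y ≠ fun _ => 1 / (m : ℝ))
    (EW EH : ℝ) (hEW : 0 < EW) (hEH : 0 < EH)
    (Y : Matrix (Fin m) G ℝ)
    (hY : ∀ g : G, (fun i => Y i g) = permMat (g : Equiv.Perm (Fin m)) *ᵥ y)
    (hactive : ∀ (W : Matrix (Fin m) (Fin d) ℝ) (H : Matrix (Fin d) G ℝ),
      IsGlobalMin EW EH Y W H → frobSq W = EW ∧ frobSq H = EH)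
    (α : Fin m → ℝ) (hα : α ∈ stdSimplex ℝ (Fin m)) (hαpos : ∀ i, 0 < α i)
    (k : ℝ)
    (hk : k = Real.sqrt (EW * EH /
      ((Fintype.card G : ℝ) * ((m : ℝ) - 1) * ∑ i, (α i - y i) ^ 2)))
    (hsys : ∀ i, k * (α i - y i) + Real.log (α i) = (1 / (m : ℝ)) * ∑ r, Real.log (α r))
    (A : Matrix (Fin m) G ℝ)
    (hA : ∀ g : G, (fun i => A i g) = permMat (g : Equiv.Perm (Fin m)) *ᵥ α)
    (C : Matrix (Fin m) G ℝ) (hCdef : C = A - Y)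
    (γ : ℝ)
    (hγ : γ = Real.sqrt ((Fintype.card G : ℝ) / ((m : ℝ) - 1)) *
      Real.sqrt (∑ i, (α i - y i) ^ 2))
    (U : Matrix (Fin m) (Fin (m - 1)) ℝ) (V : Matrix G (Fin (m - 1)) ℝ)
    (hU : Uᵀ * U = 1) (hV : Vᵀ * V = 1) (hSVD : C = γ • (U * Vᵀ)) :
    (∀ (W : Matrix (Fin m) (Fin d) ℝ) (H : Matrix (Fin d) G ℝ),
      IsGlobalMin EW EH Y W H ↔
        ∃ Q : Matrix (Fin d) (Fin (m - 1)) ℝ, Qᵀ * Q = 1 ∧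
          W = Real.sqrt (EW / ((m : ℝ) - 1)) • (U * Qᵀ) ∧
          H = -(Real.sqrt (EH / ((m : ℝ) - 1)) • (Q * Vᵀ))) ∧
    (∀ (W : Matrix (Fin m) (Fin d) ℝ) (H : Matrix (Fin d) G ℝ),
      IsGlobalMin EW EH Y W H →
        W * Wᵀ = (EW / ((m : ℝ) - 1)) •
            ((1 : Matrix (Fin m) (Fin m) ℝ) -
              ((1 : ℝ) / (m : ℝ)) • Matrix.of (fun _ _ => (1 : ℝ))) ∧
        Hᵀ * H = (EH / (((m : ℝ) - 1) * γ ^ 2)) • (Cᵀ * C) ∧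
        W * H = (-k) • C) := by
  have : NeZero m := ⟨by omega⟩
  have hm1 : (0 : ℝ) < (m : ℝ) - 1 := by
    have : (2 : ℝ) ≤ m := by exact_mod_cast hm
    linarith
  have hcast : ((m - 1 : ℕ) : ℝ) = (m : ℝ) - 1 := by
    rw [Nat.cast_sub (by omega), Nat.cast_one]
  have hYap : ∀ g i, Y i g = y ((g : Equiv.Perm (Fin m))⁻¹ i) := fun g i =>
    (congrFun (hY g) i).trans (permMat_mulVec _ _ _)
  have hAap : ∀ g i, A i g = α ((g : Equiv.Perm (Fin m))⁻¹ i) := fun g i =>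
    (congrFun (hA g) i).trans (permMat_mulVec _ _ _)
  have hYsum : ∀ g, ∑ i, Y i g = 1 := fun g => by
    simp only [hYap]
    rw [Equiv.sum_comp ((g : Equiv.Perm (Fin m))⁻¹) y, hy.2]
  have hAsum : ∀ g, ∑ i, A i g = 1 := fun g => by
    simp only [hAap]
    rw [Equiv.sum_comp ((g : Equiv.Perm (Fin m))⁻¹) α, hα.2]
  have hCap : ∀ i g, C i g = A i g - Y i g := fun i g => by rw [hCdef, Matrix.sub_apply]
  have hCsum : ∀ g, ∑ i, C i g = 0 := fun g => by
    simp only [hCap, Finset.sum_sub_distrib, hYsum, hAsum, sub_self]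
  have hS : 0 < ∑ i, (α i - y i) ^ 2 := by
    refine lt_of_le_of_ne (Finset.sum_nonneg fun i _ => sq_nonneg _) fun h0 => hyn ?_
    have heq : ∀ i, α i = y i := fun i => by
      have := (Finset.sum_eq_zero_iff_of_nonneg fun i _ => sq_nonneg (α i - y i)).mp h0.symm i
        (Finset.mem_univ i)
      exact sub_eq_zero.mp (pow_eq_zero_iff two_ne_zero |>.mp this)
    have hconst : ∀ i j, α i = α j := fun i j => by
      have hi := hsys i
      have hj := hsys j
      rw [heq, sub_self, mul_zero, zero_add, ← heq] at hi hj
      exact Real.log_injOn_pos (hαpos i) (hαpos j) (hi.trans hj.symm)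
    funext i
    have h1 : ∑ j, α j = m * α i := by
      rw [Finset.sum_congr rfl fun j _ => hconst j i]
      simp
    rw [hα.2] at h1
    rw [← heq, eq_div_iff (Nat.cast_ne_zero.mpr (NeZero.ne m)), mul_comm]
    exact h1.symm
  have hGc : (0 : ℝ) < Fintype.card G := by exact_mod_cast Fintype.card_pos
  have hγpos : 0 < γ := by
    rw [hγ]
    positivity
  set a := Real.sqrt EW with ha
  set b := Real.sqrt EH with hb
  have hapos : 0 < a := Real.sqrt_pos.mpr hEW
  have hbpos : 0 < b := Real.sqrt_pos.mpr hEH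
  have ha2 : a ^ 2 = EW := Real.sq_sqrt hEW.le
  have hb2 : b ^ 2 = EH := Real.sq_sqrt hEH.le
  have hkγ : k * γ * ((m : ℝ) - 1) = a * b := by
    have h0 : 0 ≤ k := hk ▸ Real.sqrt_nonneg _
    refine (sq_eq_sq₀ (by positivity) (by positivity)).mp ?_
    rw [mul_pow, mul_pow, mul_pow, hk, hγ, mul_pow, Real.sq_sqrt (by positivity),
      Real.sq_sqrt (by positivity), Real.sq_sqrt hS.le, ha2, hb2]
    field_simp
  have hsm : ∀ g, softmax (fun i => ((-k) • C) i g) = fun i => A i g := fun g => by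
    refine softmax_eq_of_log (c := (1 / (m : ℝ)) * ∑ r, Real.log (α r))
      (fun i => by rw [hAap]; exact hαpos _) (hAsum g) fun i => ?_
    rw [Matrix.smul_apply, hCap, hAap, hYap, smul_eq_mul,
      ← hsys ((g : Equiv.Perm (Fin m))⁻¹ i)]
    ring
  have hU0 : ∀ j, ∑ i, U i j = 0 := fun j => by
    have h1 : C * V = γ • U := by
      rw [hSVD, Matrix.smul_mul, Matrix.mul_assoc, hV, Matrix.mul_one]
    have h2 : ∑ i, (C * V) i j = 0 := by
      simp only [Matrix.mul_apply]
      rw [Finset.sum_comm]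
      simp [← Finset.sum_mul, hCsum]
    rw [h1] at h2
    simp only [Matrix.smul_apply, smul_eq_mul, ← Finset.mul_sum] at h2
    exact (mul_eq_zero.mp h2).resolve_left hγpos.ne'
  have htrC : ∀ (W : Matrix (Fin m) (Fin d) ℝ) (H : Matrix (Fin d) G ℝ),
      ∑ g, ∑ i, (A i g - Y i g) * ((W * H) i g - ((-k) • C) i g) =
        γ * (((Uᵀ * W)ᵀ * (Vᵀ * Hᵀ)).trace + a * b) := fun W H => by
    have h1 : (Cᵀ * (W * H)).trace = γ * ((Uᵀ * W)ᵀ * (Vᵀ * Hᵀ)).trace := by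
      rw [hSVD, Matrix.transpose_smul, Matrix.smul_mul, Matrix.trace_smul, smul_eq_mul,
        ← Matrix.trace_transpose ((Uᵀ * W)ᵀ * (Vᵀ * Hᵀ))]
      simp only [Matrix.transpose_mul, Matrix.transpose_transpose]
      rw [Matrix.trace_mul_comm (H * V)]
      simp only [Matrix.mul_assoc]
      rw [Matrix.trace_mul_comm V]
      simp only [Matrix.mul_assoc]
    have h2 : (Cᵀ * C).trace = γ ^ 2 * ((m : ℝ) - 1) := by
      rw [← frobSq_eq_trace_s17, hSVD, frobSq_smul_s17, frobSq_mul_of_orthonormal hU, frobSq_transpose_s17,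
        frobSq_of_orthonormal hV, Fintype.card_fin, hcast]
    have h3 : ∑ g, ∑ i, (A i g - Y i g) * ((W * H) i g - ((-k) • C) i g) =
        (Cᵀ * (W * H - (-k) • C)).trace := by
      rw [trace_transpose_mul_eq_sum]
      simp only [hCap, Matrix.sub_apply]
    rw [h3, Matrix.mul_sub, Matrix.mul_smul, Matrix.trace_sub, Matrix.trace_smul, h1, h2, ← hkγ,
      smul_eq_mul]
    ring
  set J := ∑ g, crossEnt (softmax fun i => ((-k) • C) i g) (fun i => Y i g) with hJ
  have hlow : ∀ (W : Matrix (Fin m) (Fin d) ℝ) (H : Matrix (Fin d) G ℝ),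
      J + γ * (((Uᵀ * W)ᵀ * (Vᵀ * Hᵀ)).trace + a * b) ≤ lpObj W H Y := fun W H => by
    rw [← htrC, hJ, lpObj, ← Finset.sum_add_distrib]
    refine Finset.sum_le_sum fun g _ => ?_
    have := crossEnt_softmax_ge (hYsum g) (fun i => (W * H) i g) (fun i => ((-k) • C) i g)
    simpa only [hsm] using this
  have hsqrtW : Real.sqrt (EW / ((m : ℝ) - 1)) = a / Real.sqrt ((m : ℝ) - 1) :=
    Real.sqrt_div hEW.le _
  have hsqrtH : Real.sqrt (EH / ((m : ℝ) - 1)) = b / Real.sqrt ((m : ℝ) - 1) :=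
    Real.sqrt_div hEH.le _
  set s := Real.sqrt ((m : ℝ) - 1) with hs
  have hspos : 0 < s := Real.sqrt_pos.mpr hm1
  have hs2 : s ^ 2 = (m : ℝ) - 1 := Real.sq_sqrt hm1.le
  have hkγs : k * γ = a * b / s ^ 2 := by
    rw [hs2, eq_div_iff hm1.ne', hkγ]
  have hprod : ∀ Q : Matrix (Fin d) (Fin (m - 1)) ℝ, Qᵀ * Q = 1 →
      ((a / s) • (U * Qᵀ)) * (-((b / s) • (Q * Vᵀ))) = (-k) • C := fun Q hQ => by
    rw [Matrix.mul_neg, Matrix.smul_mul, Matrix.mul_smul, Matrix.mul_assoc, ← Matrix.mul_assoc Qᵀ,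
      hQ, Matrix.one_mul, hSVD, smul_smul, smul_smul, neg_mul, neg_smul, hkγs]
    congr 2
    field_simp
  have hobj : ∀ Q : Matrix (Fin d) (Fin (m - 1)) ℝ, Qᵀ * Q = 1 →
      lpObj ((a / s) • (U * Qᵀ)) (-((b / s) • (Q * Vᵀ))) Y = J := fun Q hQ => by
    rw [lpObj, hprod Q hQ]
  have hfeasW : ∀ Q : Matrix (Fin d) (Fin (m - 1)) ℝ, Qᵀ * Q = 1 →
      frobSq ((a / s) • (U * Qᵀ)) = EW := fun Q hQ => by
    rw [frobSq_smul_s17, frobSq_mul_of_orthonormal hU, frobSq_transpose_s17, frobSq_of_orthonormal hQ,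
      Fintype.card_fin, hcast, div_pow, hs2, ha2, div_mul_cancel₀ _ hm1.ne']
  have hfeasH : ∀ Q : Matrix (Fin d) (Fin (m - 1)) ℝ, Qᵀ * Q = 1 →
      frobSq (-((b / s) • (Q * Vᵀ))) = EH := fun Q hQ => by
    rw [← neg_smul, frobSq_smul_s17, frobSq_mul_of_orthonormal hQ, frobSq_transpose_s17,
      frobSq_of_orthonormal hV, Fintype.card_fin, hcast, neg_sq, div_pow, hs2, hb2,
      div_mul_cancel₀ _ hm1.ne']
  have hiff : ∀ (W : Matrix (Fin m) (Fin d) ℝ) (H : Matrix (Fin d) G ℝ),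
      IsGlobalMin EW EH Y W H ↔ ∃ Q : Matrix (Fin d) (Fin (m - 1)) ℝ, Qᵀ * Q = 1 ∧
        W = (a / s) • (U * Qᵀ) ∧ H = -((b / s) • (Q * Vᵀ)) := fun W H => by
    constructor
    · rintro ⟨hW, hH, hmin⟩
      obtain ⟨Q₀, hQ₀⟩ := exists_orthonormal_columns (show m - 1 ≤ d by omega)
      have hle : lpObj W H Y ≤ J :=
        hobj Q₀ hQ₀ ▸ hmin _ _ (hfeasW Q₀ hQ₀).le (hfeasH Q₀ hQ₀).le
      have hW' : frobSq W ≤ a ^ 2 := ha2 ▸ hW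
      have hH' : frobSq Hᵀ ≤ b ^ 2 := by rwa [frobSq_transpose_s17, hb2]
      have htr := neg_mul_le_trace_of_orthonormal hU hV hapos hbpos hW' hH'
      have htr' : ((Uᵀ * W)ᵀ * (Vᵀ * Hᵀ)).trace + a * b = 0 := by
        have h1 := hlow W H
        have h2 : ((Uᵀ * W)ᵀ * (Vᵀ * Hᵀ)).trace + a * b ≤ 0 :=
          nonpos_of_mul_nonpos_right (by linarith : γ * _ ≤ 0) hγpos
        linarith
      obtain ⟨hWU, hHV, hWH⟩ :=
        eq_of_trace_le_neg_mul hU hV hapos hbpos hW' hH' (by linarith)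
      have hWHsum : ∀ g, ∑ i, (W * H) i g = ∑ i, ((-k) • C) i g := fun g => by
        have h1 : ∑ i, ((-k) • C) i g = 0 := by
          simp only [Matrix.smul_apply, smul_eq_mul, ← Finset.mul_sum, hCsum, mul_zero]
        rw [h1, hWU, Matrix.mul_assoc]
        simp only [Matrix.mul_apply (M := U)]
        rw [Finset.sum_comm]
        simp [← Finset.sum_mul, hU0]
      have hcol : ∀ g, (fun i => (W * H) i g) = fun i => ((-k) • C) i g := by
        have hge : ∀ g ∈ Finset.univ,
            crossEnt (softmax fun i => ((-k) • C) i g) (fun i => Y i g) +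
              ∑ i, (softmax (fun i => ((-k) • C) i g) i - Y i g) *
                ((W * H) i g - ((-k) • C) i g) ≤
            crossEnt (softmax fun i => (W * H) i g) (fun i => Y i g) := fun g _ =>
          crossEnt_softmax_ge (hYsum g) (fun i => (W * H) i g) (fun i => ((-k) • C) i g)
        have hsum : ∑ g, (crossEnt (softmax fun i => ((-k) • C) i g) (fun i => Y i g) +
              ∑ i, (softmax (fun i => ((-k) • C) i g) i - Y i g) *
                ((W * H) i g - ((-k) • C) i g)) =
            ∑ g, crossEnt (softmax fun i => (W * H) i g) (fun i => Y i g) := by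
          refine le_antisymm (Finset.sum_le_sum hge) ?_
          rw [Finset.sum_add_distrib]
          simp only [hsm] at hJ ⊢
          rw [htrC, htr', mul_zero, add_zero, ← hJ]
          exact hle
        intro g
        exact eq_of_crossEnt_softmax_le (hYsum g) (hWHsum g)
          ((Finset.sum_eq_sum_iff_of_le hge).mp hsum g (Finset.mem_univ g)).ge
      have hZ : W * H = (-k) • C := by
        ext i g
        exact congrFun (hcol g) i
      set P := Uᵀ * W with hP
      have hVK : Vᵀ * Hᵀ = -((b / a) • P) := by
        have h1 : a • (Vᵀ * Hᵀ) = -(b • P) := eq_neg_of_add_eq_zero_right hWH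
        rw [← one_smul ℝ (Vᵀ * Hᵀ), ← inv_mul_cancel₀ hapos.ne', mul_smul, h1, smul_neg, smul_smul]
        congr 2
        ring
      have hH1 : H = -((b / a) • (Pᵀ * Vᵀ)) := by
        rw [← Matrix.transpose_transpose H, hHV, hVK, Matrix.mul_neg, Matrix.mul_smul,
          Matrix.transpose_neg, Matrix.transpose_smul, Matrix.transpose_mul]
      have hPP : P * Pᵀ = (a ^ 2 / s ^ 2) • (1 : Matrix (Fin (m - 1)) (Fin (m - 1)) ℝ) := by
        have h1 : Uᵀ * (W * H) * V = -((b / a) • (P * Pᵀ)) := by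
          rw [← Matrix.mul_assoc, ← hP, hH1, Matrix.mul_neg, Matrix.neg_mul, Matrix.mul_smul,
            Matrix.smul_mul, ← Matrix.mul_assoc P, Matrix.mul_assoc (P * Pᵀ), hV, Matrix.mul_one]
        have h2 : Uᵀ * (W * H) * V = -((k * γ) • (1 : Matrix (Fin (m - 1)) (Fin (m - 1)) ℝ)) := by
          rw [hZ, hSVD, smul_smul, Matrix.mul_smul, Matrix.smul_mul, ← Matrix.mul_assoc Uᵀ, hU,
            Matrix.one_mul, hV, neg_mul, neg_smul]
        have h3 : (b / a) • (P * Pᵀ) = (k * γ) • (1 : Matrix (Fin (m - 1)) (Fin (m - 1)) ℝ) :=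
          neg_injective (h1.symm.trans h2)
        have h4 := congrArg (fun M => (a / b) • M) h3
        simp only [smul_smul] at h4
        rw [div_mul_div_cancel₀ hbpos.ne', div_self hapos.ne', one_smul, hkγs] at h4
        rw [h4]
        congr 1
        field_simp
      refine ⟨(s / a) • Pᵀ, ?_, ?_, ?_⟩
      · rw [Matrix.transpose_smul, Matrix.transpose_transpose, Matrix.smul_mul, Matrix.mul_smul,
          hPP, smul_smul, smul_smul]
        convert one_smul ℝ _ using 2
        field_simp
      · rw [Matrix.transpose_smul, Matrix.transpose_transpose, Matrix.mul_smul, smul_smul, ← hWU]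
        convert (one_smul ℝ W).symm using 2
        field_simp
      · rw [Matrix.smul_mul, smul_smul, hH1]
        congr 2
        field_simp
    · rintro ⟨Q, hQ, rfl, rfl⟩
      refine ⟨(hfeasW Q hQ).le, (hfeasH Q hQ).le, fun W' H' hW hH => ?_⟩
      rw [hobj Q hQ]
      have htr := neg_mul_le_trace_of_orthonormal (K := H'ᵀ) hU hV hapos hbpos (ha2 ▸ hW)
        (by rwa [frobSq_transpose_s17, hb2])
      have h1 := hlow W' H'
      have h2 := mul_nonneg hγpos.le
        (by linarith : 0 ≤ ((Uᵀ * W')ᵀ * (Vᵀ * H'ᵀ)).trace + a * b)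
      linarith
  rw [hsqrtW, hsqrtH]
  refine ⟨hiff, fun W H hWH => ?_⟩
  obtain ⟨Q, hQ, rfl, rfl⟩ := (hiff W H).mp hWH
  refine ⟨?_, ?_, hprod Q hQ⟩
  · rw [← mul_transpose_eq_centering hU hU0, Matrix.transpose_smul, Matrix.transpose_mul,
      Matrix.transpose_transpose, Matrix.smul_mul, Matrix.mul_smul, smul_smul, Matrix.mul_assoc,
      ← Matrix.mul_assoc Qᵀ, hQ, Matrix.one_mul, ← ha2, ← hs2]
    congr 1
    field_simp
  · rw [hSVD, Matrix.transpose_neg, Matrix.neg_mul, Matrix.mul_neg, neg_neg,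
      Matrix.transpose_smul, Matrix.transpose_smul, Matrix.transpose_mul, Matrix.transpose_mul,
      Matrix.transpose_transpose, Matrix.smul_mul, Matrix.mul_smul, Matrix.smul_mul,
      Matrix.mul_smul, smul_smul, smul_smul, smul_smul, Matrix.mul_assoc V Qᵀ,
      ← Matrix.mul_assoc Qᵀ, hQ, Matrix.one_mul, Matrix.mul_assoc V Uᵀ, ← Matrix.mul_assoc Uᵀ, hU,
      Matrix.one_mul, ← hb2, ← hs2]
    congr 1
    field_simp
end
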